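/- arXiv:1404.0543 — 2 statements merged into one kernel-verified Lean document; each statement's English description precedes it below -/
import Mathlib

section
/- Let L be a Lie algebra over a field F and let V be a finite-dimensional irreducible L-module carrying a nondegenerate invariant bilinear form β. Then either the symmetrized form λ(v, w) := β(v, w) + β(w, v) is a nondegenerate symmetric invariant bilinear form on V, or β is skew-symmetric, i.e. β(v, w) = −β(w, v) for all v, w ∈ V. -/
/-- Let `β` be a nondegenerate invariant bilinear form on a finite-dimensional
irreducible `L`-module `V`. Then either the symmetrization
`lam(v, w) = β(v, w) + β(w, v)` is a nondegenerate symmetric invariant bilinear form,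
or `β` is skew-symmetric. -/
theorem symmetrization_nondegenerate_or_skew
    (F : Type*) [Field F] (L : Type*) [LieRing L] [LieAlgebra F L]
    (V : Type*) [AddCommGroup V] [Module F V] [LieRingModule L V] [LieModule F L V]
    [FiniteDimensional F V]
    (hnz : Nontrivial V)
    (hirr : ∀ N : LieSubmodule F L V, N = ⊥ ∨ N = ⊤)
    (β : V →ₗ[F] V →ₗ[F] F)
    (hinv : ∀ (x : L) (v w : V), β ⁅x, v⁆ w = - β v ⁅x, w⁆)
    (hnd : ∀ v : V, (∀ w : V, β v w = 0) → v = 0) :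
    ((∀ v w : V, β v w + β w v = β w v + β v w) ∧
     (∀ (x : L) (v w : V), β ⁅x, v⁆ w + β w ⁅x, v⁆ = -(β v ⁅x, w⁆ + β ⁅x, w⁆ v)) ∧
     (∀ v : V, (∀ w : V, β v w + β w v = 0) → v = 0)) ∨
    (∀ v w : V, β v w = - β w v) := by
  have hinv2 : ∀ (x : L) (v w : V),
      β ⁅x, v⁆ w + β w ⁅x, v⁆ = -(β v ⁅x, w⁆ + β ⁅x, w⁆ v) := by
    intro x v w
    rw [hinv x v w, hinv x w v]
    ring
  let N : LieSubmodule F L V :=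
    { carrier := {v | ∀ w : V, β v w + β w v = 0}
      add_mem' := by
        intro a b ha hb w
        have h1 := ha w
        have h2 := hb w
        simp only [map_add, LinearMap.add_apply]
        linear_combination h1 + h2
      zero_mem' := by
        intro w
        simp
      smul_mem' := by
        intro c a ha w
        have h1 := ha w
        simp only [map_smul, LinearMap.smul_apply, smul_eq_mul]
        linear_combination c * h1
      lie_mem := by
        intro x m hm w
        have h1 := hm ⁅x, w⁆
        rw [hinv2, h1, neg_zero] }
  rcases hirr N with h | h
  · left
    refine ⟨fun v w => add_comm _ _, hinv2, fun v hv => ?_⟩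
    have hm : v ∈ N := hv
    rw [h] at hm
    simpa using hm
  · right
    intro v w
    have hm : v ∈ N := by
      rw [h]
      exact LieSubmodule.mem_top v
    exact eq_neg_of_add_eq_zero_left (hm w)
end

section
/- Let L be a Lie algebra over a field F and let V be a finite-dimensional irreducible L-module which is isomorphic to its dual V* as an L-module. Then there exists a nondegenerate invariant bilinear form on V which is either symmetric or skew-symmetric. -/
/-- A finite-dimensional irreducible `L`-module that is isomorphic to its dual
(the dual carrying the action `(x·f)(v) = −f(x·v)`) possesses a nondegenerate
invariant bilinear form which is either symmetric or skew-symmetric. -/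
theorem self_dual_irreducible_has_symmetric_or_skew_form
    (F : Type*) [Field F] (L : Type*) [LieRing L] [LieAlgebra F L]
    (V : Type*) [AddCommGroup V] [Module F V] [LieRingModule L V] [LieModule F L V]
    [FiniteDimensional F V]
    (hnz : Nontrivial V)
    (hirr : ∀ N : LieSubmodule F L V, N = ⊥ ∨ N = ⊤)
    (hdual : ∃ φ : V ≃ₗ[F] Module.Dual F V,
      ∀ (x : L) (v w : V), φ ⁅x, v⁆ w = - φ v ⁅x, w⁆) :
    ∃ lam : V →ₗ[F] V →ₗ[F] F,
      (∀ (x : L) (v w : V), lam ⁅x, v⁆ w = - lam v ⁅x, w⁆) ∧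
      (∀ v : V, (∀ w : V, lam v w = 0) → v = 0) ∧
      ((∀ v w : V, lam v w = lam w v) ∨ (∀ v w : V, lam v w = - lam w v)) := by
  obtain ⟨φ, hφ⟩ := hdual
  have hφ' : ∀ (x : L) (v w : V), φ w ⁅x, v⁆ = - φ ⁅x, w⁆ v := by
    intro x v w
    rw [hφ, neg_neg]
  let b : V →ₗ[F] V →ₗ[F] F := φ.toLinearMap
  let s : V →ₗ[F] V →ₗ[F] F := b + b.flip
  have hs : ∀ v w, s v w = φ v w + φ w v := fun v w => rfl
  have hinv : ∀ (x : L) (v w : V), s ⁅x, v⁆ w = - s v ⁅x, w⁆ := by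
    intro x v w
    rw [hs, hs, hφ, hφ' x v w]
    ring
  -- the radical of the symmetrized form is a submodule
  let N : LieSubmodule F L V :=
    { LinearMap.ker s with
      lie_mem := by
        intro x m hm
        have hm' : s m = 0 := hm
        change s ⁅x, m⁆ = 0
        ext w
        rw [hinv, hm']
        simp }
  have hN : ∀ v, v ∈ N ↔ s v = 0 := fun v => Iff.rfl
  rcases hirr N with h | h
  · refine ⟨s, hinv, ?_, Or.inl ?_⟩
    · intro v hv
      have hmem : v ∈ N := (hN v).2 (LinearMap.ext hv)
      rw [h] at hmem
      simpa using hmem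
    · intro v w
      rw [hs, hs, add_comm]
  · refine ⟨b, hφ, ?_, Or.inr ?_⟩
    · intro v hv
      have h0 : φ v = 0 := LinearMap.ext hv
      simpa using h0
    · intro v w
      have hmem : v ∈ N := by rw [h]; trivial
      have h0 : s v w = 0 := by rw [(hN v).1 hmem]; rfl
      rw [hs] at h0
      exact eq_neg_of_add_eq_zero_left h0
end
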